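/- Let E be a Banach space, let λ ∈ [0, 1/2), let f : ℝ^d → E be a Lebesgue measurable function, and let Q ⊆ ℝ^d be a Lebesgue measurable set with 0 < |Q| < ∞. If ω_λ(f; Q) = 0, then there exists a vector c ∈ E such that ρ_λ(f − c; Q) = 0. -/

import Mathlib

open MeasureTheory Set

/-- The least bound `ρ_λ(f;Q)`: the infimum of all `r ≥ 0` such that
`|{x ∈ Q : ‖f(x)‖ > r}| ≤ λ|Q|`. -/
noncomputable def leastBound {E : Type*} [NormedAddCommGroup E] {d : ℕ} (lam : ℝ)
    (f : (Fin d → ℝ) → E) (Q : Set (Fin d → ℝ)) : ℝ :=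
  sInf {r : ℝ | 0 ≤ r ∧ volume {x ∈ Q | r < ‖f x‖} ≤ ENNReal.ofReal lam * volume Q}

/-- The local oscillation `ω_λ(f;Q) := inf_{c ∈ E} ρ_λ(f - c; Q)`. -/
noncomputable def localOsc {E : Type*} [NormedAddCommGroup E] {d : ℕ} (lam : ℝ)
    (f : (Fin d → ℝ) → E) (Q : Set (Fin d → ℝ)) : ℝ :=
  ⨅ c : E, leastBound lam (fun x => f x - c) Q

lemma leastBound_nonneg {E : Type*} [NormedAddCommGroup E] {d : ℕ} (lam : ℝ)
    (f : (Fin d → ℝ) → E) (Q : Set (Fin d → ℝ)) : 0 ≤ leastBound lam f Q :=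
  Real.sInf_nonneg fun _ hr => hr.1

lemma measure_le_of_leastBound_lt {E : Type*} [NormedAddCommGroup E] {d : ℕ} {lam : ℝ}
    {f : (Fin d → ℝ) → E} {Q : Set (Fin d → ℝ)} {r : ℝ}
    (hne : {r : ℝ | 0 ≤ r ∧
      volume {x ∈ Q | r < ‖f x‖} ≤ ENNReal.ofReal lam * volume Q}.Nonempty)
    (hr : leastBound lam f Q < r) :
    volume {x ∈ Q | r < ‖f x‖} ≤ ENNReal.ofReal lam * volume Q := by
  obtain ⟨s, ⟨-, hs⟩, hsr⟩ := exists_lt_of_csInf_lt hne hr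
  have hsub : {x ∈ Q | r < ‖f x‖} ⊆ {x ∈ Q | s < ‖f x‖} := fun x hx => ⟨hx.1, hsr.trans hx.2⟩
  exact (measure_mono hsub).trans hs

lemma leastBound_le {E : Type*} [NormedAddCommGroup E] {d : ℕ} {lam : ℝ}
    {f : (Fin d → ℝ) → E} {Q : Set (Fin d → ℝ)} {r : ℝ} (hr : 0 ≤ r)
    (h : volume {x ∈ Q | r < ‖f x‖} ≤ ENNReal.ofReal lam * volume Q) :
    leastBound lam f Q ≤ r :=
  csInf_le ⟨0, fun _ hs => hs.1⟩ ⟨hr, h⟩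

/-- Two exceptional sets of relative measure at most `lam < 1 / 2` do not cover `Q`, so the two
centers are close to a common value of `f`. -/
lemma dist_le_add_of_measure_le {E : Type*} [NormedAddCommGroup E] {d : ℕ} {lam : ℝ}
    (hlam : lam < 1 / 2) {f : (Fin d → ℝ) → E} {Q : Set (Fin d → ℝ)}
    (hQpos : 0 < volume Q) (hQfin : volume Q < ⊤) {a b : E} {r s : ℝ}
    (ha : volume {x ∈ Q | r < ‖f x - a‖} ≤ ENNReal.ofReal lam * volume Q)
    (hb : volume {x ∈ Q | s < ‖f x - b‖} ≤ ENNReal.ofReal lam * volume Q) :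
    dist a b ≤ r + s := by
  by_contra! hab
  have hcover : Q ⊆ {x ∈ Q | r < ‖f x - a‖} ∪ {x ∈ Q | s < ‖f x - b‖} := by
    intro x hx
    by_contra hx'
    simp only [mem_union, mem_ofPred_eq, hx, true_and, not_or, not_lt] at hx'
    have := dist_triangle_left a b (f x)
    rw [dist_eq_norm (f x), dist_eq_norm (f x)] at this
    linarith [hx'.1, hx'.2]
  have hle : volume Q ≤ (ENNReal.ofReal lam + ENNReal.ofReal lam) * volume Q :=
    calc volume Q ≤ _ := measure_mono hcover
      _ ≤ _ := measure_union_le _ _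
      _ ≤ _ := by rw [add_mul]; exact add_le_add ha hb
  have hlt : ENNReal.ofReal lam + ENNReal.ofReal lam < 1 := by
    have h2 : ENNReal.ofReal lam < ENNReal.ofReal (1 / 2) :=
      (ENNReal.ofReal_lt_ofReal_iff (by norm_num)).2 hlam
    calc _ < ENNReal.ofReal (1 / 2) + ENNReal.ofReal (1 / 2) := ENNReal.add_lt_add h2 h2
      _ = 1 := by
        rw [← ENNReal.ofReal_add (by norm_num) (by norm_num)]
        norm_num
  have := ENNReal.mul_lt_mul_left hQpos.ne' hQfin.ne hlt
  rw [one_mul] at this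
  exact absurd hle this.not_ge

/-- if `ω_λ(f;Q) = 0` then there is `c ∈ E` with `ρ_λ(f - c; Q) = 0`. -/
theorem localOsc_eq_zero_exists_center {E : Type*} [NormedAddCommGroup E] [NormedSpace ℝ E]
    [CompleteSpace E] {d : ℕ} (lam : ℝ) (hlam0 : 0 ≤ lam) (hlam : lam < 1 / 2)
    (f : (Fin d → ℝ) → E) (hf : AEStronglyMeasurable f volume)
    (Q : Set (Fin d → ℝ)) (hQmeas : MeasurableSet Q)
    (hQpos : 0 < volume Q) (hQfin : volume Q < ⊤)
    (h : localOsc lam f Q = 0) :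
    ∃ c : E, leastBound lam (fun x => f x - c) Q = 0 := by
  by_cases hne : ∀ c : E, {r : ℝ | 0 ≤ r ∧
      volume {x ∈ Q | r < ‖f x - c‖} ≤ ENNReal.ofReal lam * volume Q}.Nonempty
  swap
  -- If no bound is admissible for some `c`, the infimum over the empty set is `0`.
  · push Not at hne
    obtain ⟨c, hc⟩ := hne
    exact ⟨c, by rw [leastBound, hc, Real.sInf_empty]⟩
  have key : ∀ n : ℕ, ∃ c : E, volume {x ∈ Q | 1 / ((n : ℝ) + 1) < ‖f x - c‖} ≤
      ENNReal.ofReal lam * volume Q := fun n => by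
    have hpos : localOsc lam f Q < 1 / ((n : ℝ) + 1) := h ▸ Nat.one_div_pos_of_nat
    obtain ⟨c, hc⟩ := exists_lt_of_ciInf_lt hpos
    exact ⟨c, measure_le_of_leastBound_lt (hne c) hc⟩
  choose u hu using key
  have hlim := tendsto_one_div_add_atTop_nhds_zero_nat (𝕜 := ℝ)
  have hcauchy : CauchySeq u := by
    refine cauchySeq_of_le_tendsto_0 (fun n : ℕ => 1 / ((n : ℝ) + 1) + 1 / ((n : ℝ) + 1))
      (fun n m N hn hm => ?_) (by simpa using hlim.add hlim)
    exact (dist_le_add_of_measure_le hlam hQpos hQfin (hu n) (hu m)).trans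
      (add_le_add (Nat.one_div_le_one_div hn) (Nat.one_div_le_one_div hm))
  obtain ⟨c, hc⟩ := cauchySeq_tendsto_of_complete hcauchy
  refine ⟨c, le_antisymm (le_of_forall_pos_le_add fun δ hδ => ?_) (leastBound_nonneg _ _ _)⟩
  rw [zero_add]
  obtain ⟨n, hn, hnc⟩ := ((hlim.eventually_lt_const (half_pos hδ)).and
    (Metric.tendsto_nhds.1 hc _ (half_pos hδ))).exists
  have hsub : {x ∈ Q | δ < ‖f x - c‖} ⊆ {x ∈ Q | 1 / ((n : ℝ) + 1) < ‖f x - u n‖} := by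
    refine fun x hx => ⟨hx.1, ?_⟩
    have htri := dist_triangle (f x) (u n) c
    rw [dist_eq_norm (f x), dist_eq_norm (f x)] at htri
    have hx2 : δ < ‖f x - c‖ := hx.2
    linarith
  exact leastBound_le hδ.le ((measure_mono hsub).trans (hu n))
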